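/- arXiv:2302.03415 — 4 statements merged into one kernel-verified Lean document; each statement's English description precedes it below -/
import Mathlib

section
/- Let p be the Gaussian density on ℝⁿ with mean μ and covariance Σ, let A be an n×n real matrix, b ∈ ℝⁿ, and let D be a diagonal n×n real matrix with positive diagonal entries D_ii. Setting μ̇ := Aμ + b, the entropy production integral satisfies ∑_{i=1}^n (1/D_ii) ∫_{ℝⁿ} p(x) · ((Ax+b)_i + D_ii·(Σ⁻¹(x−μ))_i)² dx = μ̇ᵀD⁻¹μ̇ + Tr(AᵀD⁻¹AΣ) + Tr(Σ⁻¹D) + 2·Tr(A). -/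
open Matrix MeasureTheory Real

/-- The Gaussian probability density on `ℝⁿ` with mean `μ` and covariance matrix `V`:
`p(x) = det(2πV)^(-1/2) · exp(-(1/2)(x-μ)ᵀ V⁻¹ (x-μ))`. -/
noncomputable def gaussianPDF {n : ℕ} (μ : Fin n → ℝ) (V : Matrix (Fin n) (Fin n) ℝ)
    (x : Fin n → ℝ) : ℝ :=
  (Real.sqrt ((2 * Real.pi) ^ n * V.det))⁻¹ *
    Real.exp (-(1 / 2) * ((x - μ) ⬝ᵥ (V⁻¹ *ᵥ (x - μ))))

local notation "φ₀" => ProbabilityTheory.gaussianPDFReal 0 1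

lemma phi_integrable_pow (m : ℕ) :
    Integrable (fun t : ℝ => φ₀ t * t ^ m) := by
  have h : Integrable (fun t : ℝ => t ^ m) (ProbabilityTheory.gaussianReal 0 1) := by
    have := (ProbabilityTheory.memLp_id_gaussianReal (μ := 0) (v := 1) (m : NNReal))
    have h2 := MemLp.integrable_norm_pow' (p := m) (by simpa using this)
    refine h2.mono (by fun_prop) (by simp)
  rw [ProbabilityTheory.gaussianReal_of_var_ne_zero _ one_ne_zero,
    integrable_withDensity_iff_integrable_smul' (ProbabilityTheory.measurable_gaussianPDF _ _)
     (by simp [ProbabilityTheory.gaussianPDF_lt_top])] at h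
  simpa using h

lemma phi_zero : ∫ t : ℝ, φ₀ t * t ^ 0 = 1 := by
  simpa using ProbabilityTheory.integral_gaussianPDFReal_eq_one 0 (v := 1) one_ne_zero

lemma phi_one : ∫ t : ℝ, φ₀ t * t ^ 1 = 0 := by
  have := ProbabilityTheory.integral_id_gaussianReal (μ := 0) (v := 1)
  rw [ProbabilityTheory.integral_gaussianReal_eq_integral_smul one_ne_zero] at this
  simpa using this

lemma phi_two : ∫ t : ℝ, φ₀ t * t ^ 2 = 1 := by
  have := ProbabilityTheory.variance_fun_id_gaussianReal (μ := 0) (v := 1)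
  rw [ProbabilityTheory.variance_eq_integral (by fun_prop),
    ProbabilityTheory.integral_id_gaussianReal,
    ProbabilityTheory.integral_gaussianReal_eq_integral_smul one_ne_zero] at this
  simpa using this

noncomputable def stdPhi {n : ℕ} (z : Fin n → ℝ) : ℝ := ∏ k, φ₀ (z k)

lemma std_integrable {n : ℕ} (m : Fin n → ℕ) :
    Integrable (fun z : Fin n → ℝ => stdPhi z * ∏ k, z k ^ m k) := by
  simp_rw [stdPhi, ← Finset.prod_mul_distrib]
  exact Integrable.fintype_prod (f := fun k t => φ₀ t * t ^ m k)
    (μ := fun _ => volume) (fun k => phi_integrable_pow (m k))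

lemma std_integral {n : ℕ} (m : Fin n → ℕ) :
    ∫ z : Fin n → ℝ, stdPhi z * ∏ k, z k ^ m k = ∏ k, ∫ t : ℝ, φ₀ t * t ^ m k := by
  simp_rw [stdPhi, ← Finset.prod_mul_distrib]
  exact integral_fintype_prod_volume_eq_prod (fun k t => φ₀ t * t ^ m k)

lemma prod_single {n : ℕ} (i : Fin n) (z : Fin n → ℝ) :
    ∏ k, z k ^ (Pi.single i 1 : Fin n → ℕ) k = z i := by
  rw [Finset.prod_eq_single i]
  · simp
  · intro k _ hk; simp [hk]
  · simp

lemma prod_single2 {n : ℕ} (i j : Fin n) (z : Fin n → ℝ) :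
    ∏ k, z k ^ (Pi.single i 1 + Pi.single j 1 : Fin n → ℕ) k = z i * z j := by
  simp_rw [Pi.add_apply, pow_add, Finset.prod_mul_distrib, prod_single]

lemma std0_int {n : ℕ} : Integrable (fun z : Fin n → ℝ => stdPhi z) := by
  simpa using std_integrable (n := n) 0
lemma std1_int {n : ℕ} (i : Fin n) : Integrable (fun z : Fin n → ℝ => stdPhi z * z i) := by
  simpa [prod_single] using std_integrable (n := n) (Pi.single i 1)
lemma std2_int {n : ℕ} (i j : Fin n) :
    Integrable (fun z : Fin n → ℝ => stdPhi z * (z i * z j)) := by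
  have := std_integrable (n := n) (Pi.single i 1 + Pi.single j 1)
  simp_rw [prod_single2] at this
  exact this

lemma std0 {n : ℕ} : ∫ z : Fin n → ℝ, stdPhi z = 1 := by
  have := std_integral (n := n) 0
  simp only [Pi.zero_apply, phi_zero] at this
  simpa using this

lemma std1 {n : ℕ} (i : Fin n) : ∫ z : Fin n → ℝ, stdPhi z * z i = 0 := by
  have := std_integral (n := n) (Pi.single i 1)
  simp_rw [prod_single] at this
  rw [this]
  refine Finset.prod_eq_zero (Finset.mem_univ i) ?_
  rw [Pi.single_eq_same, phi_one]

lemma std2 {n : ℕ} (i j : Fin n) :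
    ∫ z : Fin n → ℝ, stdPhi z * (z i * z j) = if i = j then 1 else 0 := by
  have := std_integral (n := n) (Pi.single i 1 + Pi.single j 1)
  simp_rw [prod_single2] at this
  rw [this]
  split_ifs with h
  · subst h
    refine Finset.prod_eq_one fun k _ => ?_
    by_cases hk : k = i
    · subst hk
      simp only [Pi.add_apply, Pi.single_eq_same]; exact phi_two
    · simp only [Pi.add_apply, Pi.single_eq_of_ne hk]; exact phi_zero
  · refine Finset.prod_eq_zero (Finset.mem_univ i) ?_
    simp only [Pi.add_apply, Pi.single_eq_same, Pi.single_eq_of_ne h]; exact phi_one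

lemma std_quad {n : ℕ} (c : ℝ) (w : Fin n → ℝ) :
    ∫ z : Fin n → ℝ, stdPhi z * (c + w ⬝ᵥ z) ^ 2 = c ^ 2 + w ⬝ᵥ w := by
  have e : ∀ z : Fin n → ℝ, stdPhi z * (c + w ⬝ᵥ z) ^ 2 =
      c ^ 2 * stdPhi z + ∑ i, (2 * c * w i) * (stdPhi z * z i) +
        ∑ i, ∑ j, (w i * w j) * (stdPhi z * (z i * z j)) := by
    intro z
    have h1 : ∑ i, (2 * c * w i) * (stdPhi z * z i) = 2 * c * stdPhi z * (w ⬝ᵥ z) := by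
      rw [dotProduct, Finset.mul_sum]; exact Finset.sum_congr rfl fun _ _ => by ring
    have h2 : ∑ i, ∑ j, (w i * w j) * (stdPhi z * (z i * z j)) =
        stdPhi z * ((w ⬝ᵥ z) * (w ⬝ᵥ z)) := by
      rw [dotProduct, Finset.sum_mul_sum, Finset.mul_sum]
      refine Finset.sum_congr rfl fun _ _ => ?_
      rw [Finset.mul_sum]
      exact Finset.sum_congr rfl fun _ _ => by ring
    rw [h1, h2]; ring
  simp_rw [e]
  have i1 : ∀ i ∈ Finset.univ, Integrable (fun z : Fin n → ℝ => (2 * c * w i) * (stdPhi z * z i)) :=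
    fun i _ => (std1_int i).const_mul _
  have i2 : ∀ i : Fin n, ∀ j ∈ Finset.univ,
      Integrable (fun z : Fin n → ℝ => (w i * w j) * (stdPhi z * (z i * z j))) :=
    fun i j _ => (std2_int i j).const_mul _
  have i3 : ∀ i ∈ Finset.univ, Integrable
      (fun z : Fin n → ℝ => ∑ j, (w i * w j) * (stdPhi z * (z i * z j))) :=
    fun i _ => integrable_finsetSum _ (i2 i)
  have i4 : Integrable (fun z : Fin n → ℝ =>
      c ^ 2 * stdPhi z + ∑ i, (2 * c * w i) * (stdPhi z * z i)) :=
    (std0_int.const_mul _).add (integrable_finsetSum _ i1)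
  rw [integral_add i4
      (integrable_finsetSum _ i3),
    integral_add (std0_int.const_mul _) (integrable_finsetSum _ i1),
    integral_finsetSum _ i1, integral_finsetSum _ i3, integral_const_mul, std0]
  simp_rw [integral_const_mul, std1]
  have : ∀ i, ∫ z : Fin n → ℝ, ∑ j, (w i * w j) * (stdPhi z * (z i * z j)) = w i * w i := by
    intro i
    rw [integral_finsetSum _ (i2 i)]
    simp_rw [integral_const_mul, std2]
    simp
  simp_rw [this]
  simp [dotProduct]

lemma std_change {n : ℕ} (M : Matrix (Fin n) (Fin n) ℝ) (hM : M.det ≠ 0) (μ : Fin n → ℝ)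
    (g : (Fin n → ℝ) → ℝ) :
    ∫ x, g x = |M.det| * ∫ z, g (M *ᵥ z + μ) := by
  have h := Real.map_matrix_volume_pi_eq_smul_volume_pi hM
  have h2 : MeasurableEmbedding (toLin' M) := by
    have : Function.Injective (toLin' M) := by
      exact Matrix.mulVec_injective_of_isUnit
        ((Matrix.isUnit_iff_isUnit_det _).2 (isUnit_iff_ne_zero.2 hM))
    exact (LinearMap.continuous_of_finiteDimensional _).measurableEmbedding this
  have h3 := h2.integral_map (μ := volume) (fun x => g (x + μ))
  rw [h, integral_smul_measure, integral_add_right_eq_self g] at h3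
  simp only [toLin'_apply] at h3
  rw [← h3, smul_eq_mul, ENNReal.toReal_ofReal (abs_nonneg _), ← mul_assoc, ← abs_mul,
    mul_inv_cancel₀ hM]
  simp

lemma pdf_change {n : ℕ} (M V : Matrix (Fin n) (Fin n) ℝ) (hM : M.det ≠ 0) (hMV : V = M * Mᵀ)
    (μ z : Fin n → ℝ) :
    |M.det| * gaussianPDF μ V (M *ᵥ z + μ) = stdPhi z := by
  have hu : IsUnit M.det := isUnit_iff_ne_zero.2 hM
  have hut : IsUnit Mᵀ.det := by rwa [det_transpose]
  have e1 : (M *ᵥ z) ⬝ᵥ (V⁻¹ *ᵥ (M *ᵥ z)) = z ⬝ᵥ z := by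
    rw [hMV, Matrix.mul_inv_rev, mulVec_mulVec, Matrix.mul_assoc, nonsing_inv_mul _ hu, Matrix.mul_one,
      dotProduct_mulVec, ← vecMul_transpose, vecMul_vecMul, mul_nonsing_inv _ hut, vecMul_one]
  have e2 : √((2 * π) ^ n * V.det) = √(2 * π) ^ n * |M.det| := by
    rw [hMV, det_mul, det_transpose, Real.sqrt_mul (by positivity), Real.sqrt_mul_self_eq_abs]
    congr 1
    rw [Real.sqrt_eq_iff_mul_self_eq (by positivity) (by positivity), ← mul_pow,
      Real.mul_self_sqrt (by positivity)]
  have hp : |M.det| ≠ 0 := abs_ne_zero.2 hM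
  rw [gaussianPDF, add_sub_cancel_right, e1, e2, stdPhi]
  simp only [ProbabilityTheory.gaussianPDFReal]
  rw [Finset.prod_mul_distrib, ← Real.exp_sum, Finset.prod_const]
  simp only [Finset.card_univ, Fintype.card_fin, NNReal.coe_one, mul_one, sub_zero]
  rw [mul_inv, inv_pow]
  have : -(1 / 2) * (z ⬝ᵥ z) = ∑ i, -z i ^ 2 / 2 := by
    rw [dotProduct, Finset.mul_sum]; exact Finset.sum_congr rfl fun _ _ => by ring
  rw [this]
  field_simp

lemma exists_factor {n : ℕ} (V : Matrix (Fin n) (Fin n) ℝ) (hV : V.PosDef) :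
    ∃ M : Matrix (Fin n) (Fin n) ℝ, M.det ≠ 0 ∧ V = M * Mᵀ := by
  obtain ⟨B, hB⟩ : ∃ B : Matrix (Fin n) (Fin n) ℝ, V = Bᴴ * B := by
    open scoped MatrixOrder in
    exact CStarAlgebra.nonneg_iff_eq_star_mul_self.1 hV.posSemidef.nonneg
  rw [conjTranspose_eq_transpose_of_trivial] at hB
  refine ⟨Bᵀ, ?_, by simpa using hB⟩
  have := hV.det_pos
  rw [hB, det_mul] at this
  exact left_ne_zero_of_mul this.ne'

/-- entropy production of a linear Gaussian process,
`Π = ∑ᵢ (1/Dᵢᵢ) ∫ p·(Jᵢ/p)² = μ̇ᵀD⁻¹μ̇ + Tr(AᵀD⁻¹AΣ) + Tr(Σ⁻¹D) + 2Tr(A)`. -/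
theorem entropy_production_gaussian {n : ℕ} (hn : 0 < n)
    (μ : Fin n → ℝ) (V : Matrix (Fin n) (Fin n) ℝ) (hVs : V.IsSymm) (hV : V.PosDef)
    (A : Matrix (Fin n) (Fin n) ℝ) (b : Fin n → ℝ)
    (D : Matrix (Fin n) (Fin n) ℝ) (hD : D.IsDiag) (hDpos : ∀ i, 0 < D i i) :
    ∑ i, (1 / D i i) *
        ∫ x : Fin n → ℝ,
          gaussianPDF μ V x *
            ((A *ᵥ x + b) i + D i i * (V⁻¹ *ᵥ (x - μ)) i) ^ 2 =
      (A *ᵥ μ + b) ⬝ᵥ (D⁻¹ *ᵥ (A *ᵥ μ + b)) + (Aᵀ * D⁻¹ * A * V).trace +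
        (V⁻¹ * D).trace + 2 * A.trace := by
  obtain ⟨M, hM, hMV⟩ := exists_factor V hV
  obtain ⟨d, rfl⟩ : ∃ d, D = diagonal d := ⟨_, hD.diagonal_diag.symm⟩
  simp only [diagonal_apply_eq] at hDpos ⊢
  have hVu : IsUnit V.det := isUnit_iff_ne_zero.2 hV.det_pos.ne'
  have hDi : (diagonal d)⁻¹ = diagonal (fun i => 1 / d i) := by
    refine inv_eq_right_inv ?_
    rw [diagonal_mul_diagonal, ← diagonal_one]
    congr 1; ext i
    exact mul_one_div_cancel (hDpos i).ne'
  set W := (A + diagonal d * V⁻¹) * M with hW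
  have hWW : W * Wᵀ = A * V * Aᵀ + A * diagonal d + diagonal d * Aᵀ
      + diagonal d * V⁻¹ * diagonal d := by
    have hs : V⁻¹ᵀ = V⁻¹ := by rw [transpose_nonsing_inv, hVs.eq]
    calc W * Wᵀ = (A + diagonal d * V⁻¹) * (M * Mᵀ) * (A + diagonal d * V⁻¹)ᵀ := by
          simp only [hW, transpose_mul, Matrix.mul_assoc]
      _ = (A * V + diagonal d) * (Aᵀ + V⁻¹ * diagonal d) := by
          rw [← hMV, transpose_add, transpose_mul, hs, diagonal_transpose, Matrix.add_mul,
            nonsing_inv_mul_cancel_right _ _ hVu]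
      _ = _ := by
          have : A * V * (V⁻¹ * diagonal d) = A * diagonal d := by
            rw [← Matrix.mul_assoc, mul_nonsing_inv_cancel_right _ _ hVu]
          rw [Matrix.add_mul, Matrix.mul_add, Matrix.mul_add, this, Matrix.mul_assoc (diagonal d)]
          abel
  have key : ∀ i, ∫ x : Fin n → ℝ, gaussianPDF μ V x *
            ((A *ᵥ x + b) i + d i * (V⁻¹ *ᵥ (x - μ)) i) ^ 2 =
      (A *ᵥ μ + b) i ^ 2 + ((A * V * Aᵀ) i i + 2 * (A i i * d i) + d i * V⁻¹ i i * d i) := by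
    intro i
    rw [std_change M hM μ, ← integral_const_mul]
    have : ∀ z, |M.det| * (gaussianPDF μ V (M *ᵥ z + μ) *
        ((A *ᵥ (M *ᵥ z + μ) + b) i + d i * (V⁻¹ *ᵥ (M *ᵥ z + μ - μ)) i) ^ 2) =
        stdPhi z * ((A *ᵥ μ + b) i + W i ⬝ᵥ z) ^ 2 := by
      intro z
      rw [← mul_assoc, pdf_change M V hM hMV]
      congr 2
      have : W i ⬝ᵥ z = (W *ᵥ z) i := rfl
      rw [this, hW, ← mulVec_mulVec, add_mulVec, ← mulVec_mulVec, add_sub_cancel_right, mulVec_add]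
      simp only [Pi.add_apply, mulVec_diagonal]
      ring
    simp_rw [this]
    rw [std_quad]
    congr 1
    have h : W i ⬝ᵥ W i = (W * Wᵀ) i i := rfl
    rw [h, hWW]
    simp only [Matrix.add_apply, mul_diagonal, diagonal_mul, transpose_apply]
    ring
  simp_rw [key, hDi]
  have t1 : (Aᵀ * diagonal (fun i => 1 / d i) * A * V).trace =
      ∑ i, 1 / d i * (A * V * Aᵀ) i i := by
    rw [Matrix.mul_assoc, Matrix.mul_assoc, trace_mul_comm, Matrix.mul_assoc]
    simp [trace, diagonal_mul]
  rw [t1]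
  simp only [dotProduct, mulVec_diagonal, trace, diag_apply, mul_diagonal]
  rw [Finset.mul_sum, ← Finset.sum_add_distrib, ← Finset.sum_add_distrib,
    ← Finset.sum_add_distrib]
  refine Finset.sum_congr rfl fun i _ => ?_
  have := (hDpos i).ne'
  field_simp
  ring
end

section
/- Let A be an n×n real matrix, D a symmetric positive definite n×n real matrix, Σ a symmetric positive definite n×n real matrix and μ̇ ∈ ℝⁿ, and set Π := μ̇ᵀD⁻¹μ̇ + Tr(AᵀD⁻¹AΣ) + Tr(Σ⁻¹D) + 2·Tr(A). Then Tr(Σ⁻¹)·Π·Tr(D) ≥ μ̇ᵀΣ⁻¹μ̇ + Tr(Σ⁻¹(AΣ + D)Σ⁻¹(AΣ + D)ᵀ). -/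
open Matrix

lemma aux_trace_sq {n : ℕ} (C : Matrix (Fin n) (Fin n) ℝ) :
    (Cᵀ * C).trace = ∑ i, ∑ k, C i k ^ 2 := by
  simp only [Matrix.trace, Matrix.diag, Matrix.mul_apply, Matrix.transpose_apply]
  rw [Finset.sum_comm]
  simp only [sq]

lemma aux_psd {n : ℕ} {P : Matrix (Fin n) (Fin n) ℝ} (hP : P.PosSemidef) :
    ∃ C : Matrix (Fin n) (Fin n) ℝ, P = Cᵀ * C := by
  open scoped MatrixOrder in
  obtain ⟨C, hC⟩ := CStarAlgebra.nonneg_iff_eq_star_mul_self.mp hP.nonneg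
  exact ⟨C, by rw [hC, Matrix.star_eq_conjTranspose, Matrix.conjTranspose_eq_transpose_of_trivial]⟩

lemma aux_trace_mul_le {n : ℕ} {P Q : Matrix (Fin n) (Fin n) ℝ} (hP : P.PosSemidef)
    (hQ : Q.PosSemidef) : (P * Q).trace ≤ P.trace * Q.trace := by
  obtain ⟨C, rfl⟩ := aux_psd hP
  obtain ⟨E, rfl⟩ := aux_psd hQ
  have h : (Cᵀ * C * (Eᵀ * E)).trace = ((E * Cᵀ)ᵀᵀ * (E * Cᵀ)ᵀ).trace := by
    rw [Matrix.transpose_transpose, Matrix.transpose_mul, Matrix.transpose_transpose,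
      ← Matrix.mul_assoc, Matrix.trace_mul_comm]
    simp only [Matrix.mul_assoc]
  rw [h, aux_trace_sq, aux_trace_sq, aux_trace_sq, Finset.sum_mul_sum]
  refine Finset.sum_le_sum fun i _ => Finset.sum_le_sum fun j _ => ?_
  simp only [Matrix.mul_apply, Matrix.transpose_apply]
  rw [mul_comm]
  exact Finset.sum_mul_sq_le_sq_mul_sq _ _ _

lemma aux_trace_le {n : ℕ} {D W : Matrix (Fin n) (Fin n) ℝ} (hD : D.PosDef)
    (hW : W.PosSemidef) : W.trace ≤ (D⁻¹ * W).trace * D.trace := by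
  obtain ⟨B, hB⟩ := aux_psd hD.posSemidef
  have hdet : IsUnit B.det := by
    have h := hD.det_pos
    rw [hB, Matrix.det_mul, Matrix.det_transpose] at h
    exact isUnit_iff_ne_zero.mpr (fun h0 => by simp [h0] at h)
  have hY : ((B⁻¹)ᵀ * W * B⁻¹).PosSemidef := by
    have := hW.conjTranspose_mul_mul_same (B⁻¹)
    rwa [Matrix.conjTranspose_eq_transpose_of_trivial] at this
  have hBB : (B * Bᵀ).PosSemidef := by
    have := Matrix.posSemidef_self_mul_conjTranspose B
    rwa [Matrix.conjTranspose_eq_transpose_of_trivial] at this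
  have key := aux_trace_mul_le hY hBB
  have e1 : ((B⁻¹)ᵀ * W * B⁻¹ * (B * Bᵀ)).trace = W.trace := by
    have : (B⁻¹)ᵀ * W * B⁻¹ * (B * Bᵀ) = (B⁻¹)ᵀ * (W * (B⁻¹ * B) * Bᵀ) := by
      simp only [Matrix.mul_assoc]
    rw [this, Matrix.nonsing_inv_mul _ hdet, Matrix.trace_mul_comm, Matrix.mul_one,
      Matrix.mul_assoc, ← Matrix.transpose_mul, Matrix.nonsing_inv_mul _ hdet]
    simp
  have e2 : ((B⁻¹)ᵀ * W * B⁻¹).trace = (D⁻¹ * W).trace := by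
    rw [Matrix.trace_mul_comm, hB, Matrix.mul_inv_rev, Matrix.transpose_nonsing_inv,
      Matrix.mul_assoc]
  have e3 : (B * Bᵀ).trace = D.trace := by rw [Matrix.trace_mul_comm, hB]
  rwa [e1, e2, e3] at key

lemma aux_vec {n : ℕ} (P : Matrix (Fin n) (Fin n) ℝ) (v : Fin n → ℝ) :
    (P * vecMulVec v v).trace = v ⬝ᵥ (P *ᵥ v) := by
  rw [Matrix.mul_vecMulVec, Matrix.trace_vecMulVec, dotProduct_comm]

/-- inequality (Epart3) of the paper: with
`Π = μ̇ᵀD⁻¹μ̇ + Tr(AᵀD⁻¹AΣ) + Tr(Σ⁻¹D) + 2Tr(A)`, one has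
`Tr(Σ⁻¹)·Π·Tr(D) ≥ μ̇ᵀΣ⁻¹μ̇ + Tr(Σ⁻¹(AΣ + D)Σ⁻¹(AΣ + D)ᵀ)`. -/
theorem epart3_inequality {n : ℕ} (A : Matrix (Fin n) (Fin n) ℝ)
    (D : Matrix (Fin n) (Fin n) ℝ) (hDs : D.IsSymm) (hD : D.PosDef)
    (V : Matrix (Fin n) (Fin n) ℝ) (hVs : V.IsSymm) (hV : V.PosDef)
    (μd : Fin n → ℝ) :
    μd ⬝ᵥ (V⁻¹ *ᵥ μd) + (V⁻¹ * (A * V + D) * V⁻¹ * (A * V + D)ᵀ).trace ≤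
      (V⁻¹).trace *
        (μd ⬝ᵥ (D⁻¹ *ᵥ μd) + (Aᵀ * D⁻¹ * A * V).trace + (V⁻¹ * D).trace + 2 * A.trace) *
        D.trace := by
  have hVi : (V⁻¹).PosSemidef := hV.inv.posSemidef
  have hdV : IsUnit V.det := isUnit_iff_ne_zero.mpr hV.det_pos.ne'
  have hdD : IsUnit D.det := isUnit_iff_ne_zero.mpr hD.det_pos.ne'
  obtain ⟨W, hWdef⟩ : ∃ W, W = vecMulVec μd μd + (A * V + D) * V⁻¹ * (A * V + D)ᵀ := ⟨_, rfl⟩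
  have hW : W.PosSemidef := by
    rw [hWdef]
    refine Matrix.PosSemidef.add ?_ ?_
    · have := Matrix.posSemidef_vecMulVec_self_star μd
      rwa [star_trivial] at this
    · have := hVi.mul_mul_conjTranspose_same (A * V + D)
      rwa [Matrix.conjTranspose_eq_transpose_of_trivial] at this
  have hL : (V⁻¹ * W).trace =
      μd ⬝ᵥ (V⁻¹ *ᵥ μd) + (V⁻¹ * (A * V + D) * V⁻¹ * (A * V + D)ᵀ).trace := by
    rw [hWdef, Matrix.mul_add, Matrix.trace_add, aux_vec]
    simp only [Matrix.mul_assoc]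
  have hM : (A * V + D) * V⁻¹ * (A * V + D)ᵀ = A * V * Aᵀ + A * D + D * Aᵀ + D * V⁻¹ * D := by
    rw [Matrix.transpose_add, Matrix.transpose_mul, hVs.eq, hDs.eq, Matrix.add_mul,
      Matrix.mul_nonsing_inv_cancel_right _ _ hdV, Matrix.add_mul, Matrix.mul_add, Matrix.mul_add,
      ← Matrix.mul_assoc (D * V⁻¹), Matrix.nonsing_inv_mul_cancel_right _ _ hdV,
      ← Matrix.mul_assoc A]
    abel
  have hR : (D⁻¹ * W).trace =
      μd ⬝ᵥ (D⁻¹ *ᵥ μd) + (Aᵀ * D⁻¹ * A * V).trace + (V⁻¹ * D).trace + 2 * A.trace := by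
    have t1 : (D⁻¹ * (A * V * Aᵀ)).trace = (Aᵀ * D⁻¹ * A * V).trace := by
      rw [← Matrix.mul_assoc, Matrix.trace_mul_comm]
      simp only [Matrix.mul_assoc]
    have t2 : (D⁻¹ * (A * D)).trace = A.trace := by
      rw [Matrix.trace_mul_comm, Matrix.mul_nonsing_inv_cancel_right _ _ hdD]
    have t3 : (D⁻¹ * (D * Aᵀ)).trace = A.trace := by
      rw [Matrix.nonsing_inv_mul_cancel_left _ _ hdD, Matrix.trace_transpose]
    have t4 : (D⁻¹ * (D * V⁻¹ * D)).trace = (V⁻¹ * D).trace := by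
      rw [Matrix.mul_assoc D, Matrix.nonsing_inv_mul_cancel_left _ _ hdD]
    rw [hWdef, hM]
    simp only [Matrix.mul_add D⁻¹, Matrix.trace_add, aux_vec, t1, t2, t3, t4]
    ring
  rw [← hL, ← hR, mul_assoc]
  exact (aux_trace_mul_le hVi hW).trans
    (mul_le_mul_of_nonneg_left (aux_trace_le hD hW) hVi.trace_nonneg)
end

section
/- Let A be an n×n real matrix, D a symmetric positive definite n×n real matrix, Σ a symmetric positive definite n×n real matrix and μ̇ ∈ ℝⁿ. Then the entropy production satisfies the factorisation μ̇ᵀD⁻¹μ̇ + Tr(AᵀD⁻¹AΣ) + Tr(Σ⁻¹D) + 2·Tr(A) = μ̇ᵀD⁻¹μ̇ + Tr(D⁻¹(AΣ + D)Σ⁻¹(AΣ + D)ᵀ), and in particular this quantity is nonnegative. -/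
open Matrix

/-- the entropy production of a linear Gaussian process factorises as
`Π = μ̇ᵀD⁻¹μ̇ + Tr(D⁻¹(AΣ + D)Σ⁻¹(AΣ + D)ᵀ)` and is therefore nonnegative. -/
theorem entropy_production_factorisation {n : ℕ} (A : Matrix (Fin n) (Fin n) ℝ)
    (D : Matrix (Fin n) (Fin n) ℝ) (hDs : D.IsSymm) (hD : D.PosDef)
    (V : Matrix (Fin n) (Fin n) ℝ) (hVs : V.IsSymm) (hV : V.PosDef)
    (μd : Fin n → ℝ) :
    (μd ⬝ᵥ (D⁻¹ *ᵥ μd) + (Aᵀ * D⁻¹ * A * V).trace + (V⁻¹ * D).trace + 2 * A.trace =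
        μd ⬝ᵥ (D⁻¹ *ᵥ μd) + (D⁻¹ * (A * V + D) * V⁻¹ * (A * V + D)ᵀ).trace) ∧
      0 ≤ μd ⬝ᵥ (D⁻¹ *ᵥ μd) + (Aᵀ * D⁻¹ * A * V).trace + (V⁻¹ * D).trace + 2 * A.trace := by
  have hDu : IsUnit D.det := (Matrix.isUnit_iff_isUnit_det D).1 hD.isUnit
  have hVu : IsUnit V.det := (Matrix.isUnit_iff_isUnit_det V).1 hV.isUnit
  have hDi : D⁻¹ * D = 1 := Matrix.nonsing_inv_mul D hDu
  have hDi2 : D * D⁻¹ = 1 := Matrix.mul_nonsing_inv D hDu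
  have hVi : V⁻¹ * V = 1 := Matrix.nonsing_inv_mul V hVu
  have hVi2 : V * V⁻¹ = 1 := Matrix.mul_nonsing_inv V hVu
  have hexp : D⁻¹ * (A * V + D) * V⁻¹ * (A * V + D)ᵀ
      = D⁻¹ * A * V * Aᵀ + D⁻¹ * A * D + Aᵀ + V⁻¹ * D := by
    have h1 : D⁻¹ * (A * V + D) * V⁻¹ = D⁻¹ * A + V⁻¹ := by
      rw [mul_add, hDi, add_mul, one_mul, mul_assoc, mul_assoc A, hVi2, mul_one]
    have h2 : (A * V + D)ᵀ = V * Aᵀ + D := by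
      rw [transpose_add, transpose_mul, hVs.eq, hDs.eq]
    rw [h1, h2, add_mul, mul_add, mul_add, ← mul_assoc V⁻¹, hVi, one_mul, ← mul_assoc,
      ← add_assoc]
  have heq : μd ⬝ᵥ (D⁻¹ *ᵥ μd) + (Aᵀ * D⁻¹ * A * V).trace + (V⁻¹ * D).trace + 2 * A.trace =
        μd ⬝ᵥ (D⁻¹ *ᵥ μd) + (D⁻¹ * (A * V + D) * V⁻¹ * (A * V + D)ᵀ).trace := by
    have t1 : (D⁻¹ * A * V * Aᵀ).trace = (Aᵀ * D⁻¹ * A * V).trace := by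
      rw [trace_mul_comm]; simp only [mul_assoc]
    have t2 : (D⁻¹ * A * D).trace = A.trace := by
      rw [trace_mul_comm, ← mul_assoc, hDi2, one_mul]
    rw [hexp, trace_add, trace_add, trace_add, t1, t2, trace_transpose]
    ring
  refine ⟨heq, ?_⟩
  rw [heq]
  have hM : ((A * V + D) * V⁻¹ * (A * V + D)ᵀ).PosSemidef := by
    simpa using hV.inv.posSemidef.mul_mul_conjTranspose_same (A * V + D)
  have hq : 0 ≤ μd ⬝ᵥ (D⁻¹ *ᵥ μd) := by
    simpa using hD.inv.posSemidef.dotProduct_mulVec_nonneg μd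
  have ht : 0 ≤ (D⁻¹ * (A * V + D) * V⁻¹ * (A * V + D)ᵀ).trace := by
    obtain ⟨C, hC⟩ : ∃ C : Matrix (Fin n) (Fin n) ℝ, D⁻¹ = Cᴴ * C := by
      open scoped MatrixOrder in
      exact CStarAlgebra.nonneg_iff_eq_star_mul_self.mp hD.inv.posSemidef.nonneg
    have h := (hM.mul_mul_conjTranspose_same C).trace_nonneg
    rw [trace_mul_comm, ← mul_assoc, ← hC] at h
    simpa only [mul_assoc] using h
  exact add_nonneg hq ht
end

section
/- Let A be an n×n real matrix, D a diagonal n×n real matrix with positive diagonal entries, Σ a symmetric positive definite n×n real matrix and μ̇ ∈ ℝⁿ, and suppose the matrix AΣ + D is symmetric positive semidefinite. With Σ̇ := AΣ + ΣAᵀ + 2D, Π := μ̇ᵀD⁻¹μ̇ + Tr(AᵀD⁻¹AΣ) + Tr(Σ⁻¹D) + 2·Tr(A) and Π_u := ‖μ̇‖²·Tr(D⁻¹) + (1/4)·Tr(Σ⁻¹)·Tr(Σ̇)²·Tr(D⁻¹), one has Π_u ≥ Π. -/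
open Matrix

theorem aux_entry {n : ℕ} (P : Matrix (Fin n) (Fin n) ℝ) (hP : P.PosSemidef) (i j : Fin n) :
    P i j ^ 2 ≤ P i i * P j j := by
  have h := (hP.submatrix ![i, j]).det_nonneg
  rw [Matrix.det_fin_two] at h
  have hs : P j i = P i j := by simpa using hP.1.apply i j
  simp [hs] at h
  nlinarith

theorem aux_trace {n : ℕ} (P Q : Matrix (Fin n) (Fin n) ℝ) (hP : P.PosSemidef)
    (hQ : Q.PosSemidef) : (P * Q).trace ≤ P.trace * Q.trace := by
  have key : ∀ i j, P i j * Q j i ≤ (P i i * Q j j + P j j * Q i i) / 2 := by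
    intro i j
    have h1 := aux_entry P hP i j
    have h2 := aux_entry Q hQ j i
    have p1 : 0 ≤ P i i := hP.diag_nonneg
    have p2 : 0 ≤ P j j := hP.diag_nonneg
    have q1 : 0 ≤ Q i i := hQ.diag_nonneg
    have q2 : 0 ≤ Q j j := hQ.diag_nonneg
    have h3 : P i j ^ 2 * Q j i ^ 2 ≤ (P i i * P j j) * (Q j j * Q i i) :=
      mul_le_mul h1 h2 (sq_nonneg _) (by positivity)
    apply le_of_abs_le
    apply abs_le_of_sq_le_sq _ (by positivity)
    nlinarith [sq_nonneg (P i i * Q j j - P j j * Q i i)]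
  calc (P * Q).trace = ∑ i, ∑ j, P i j * Q j i := by
        simp [Matrix.trace, Matrix.mul_apply]
    _ ≤ ∑ i, ∑ j, (P i i * Q j j + P j j * Q i i) / 2 :=
        Finset.sum_le_sum fun i _ => Finset.sum_le_sum fun j _ => key i j
    _ = P.trace * Q.trace := by
        simp only [← Finset.sum_div, Finset.sum_add_distrib, ← Finset.mul_sum, ← Finset.sum_mul,
          Matrix.trace, Matrix.diag_apply]
        ring

/-- the quantity `Π_u = ‖μ̇‖²·Tr(D⁻¹) + (1/4)·Tr(Σ⁻¹)·Tr(Σ̇)²·Tr(D⁻¹)`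
(with `Σ̇ = AΣ + ΣAᵀ + 2D`) is an upper bound of the entropy production
`Π = μ̇ᵀD⁻¹μ̇ + Tr(AᵀD⁻¹AΣ) + Tr(Σ⁻¹D) + 2Tr(A)`, assuming `AΣ + D` is symmetric
positive semidefinite. -/
theorem entropy_production_upper_bound {n : ℕ} (A : Matrix (Fin n) (Fin n) ℝ)
    (D : Matrix (Fin n) (Fin n) ℝ) (hD : D.IsDiag) (hDpos : ∀ i, 0 < D i i)
    (V : Matrix (Fin n) (Fin n) ℝ) (hVs : V.IsSymm) (hV : V.PosDef)
    (μd : Fin n → ℝ) (hAVD : (A * V + D).PosSemidef) :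
    μd ⬝ᵥ (D⁻¹ *ᵥ μd) + (Aᵀ * D⁻¹ * A * V).trace + (V⁻¹ * D).trace + 2 * A.trace ≤
      μd ⬝ᵥ μd * (D⁻¹).trace +
        (1 / 4) * (V⁻¹).trace * (A * V + V * Aᵀ + (2 : ℝ) • D).trace ^ 2 * (D⁻¹).trace := by
  have hDd : D = diagonal (fun i => D i i) := hD.diagonal_diag.symm
  have hDP : D.PosDef := by
    rw [hDd]
    exact Matrix.PosDef.diagonal hDpos
  have hDi : (D⁻¹).PosSemidef := hDP.inv.posSemidef
  have hVi : (V⁻¹).PosSemidef := hV.inv.posSemidef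
  have hDT : Dᵀ = D := by simpa using hDP.1.eq
  have hVu : IsUnit V.det := (Matrix.isUnit_iff_isUnit_det V).1 hV.isUnit
  have hDu : IsUnit D.det := (Matrix.isUnit_iff_isUnit_det D).1 hDP.isUnit
  obtain ⟨M, hM⟩ : ∃ M, M = A * V + D := ⟨_, rfl⟩
  rw [← hM] at hAVD
  have hMT : Mᵀ = M := by simpa using hAVD.1.eq
  have hAV : A * V = M - D := by rw [hM]; abel
  have hA : A = (M - D) * V⁻¹ := by
    rw [← hAV, Matrix.mul_assoc, Matrix.mul_nonsing_inv _ hVu, Matrix.mul_one]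
  have hVA : V * Aᵀ = M - D := by
    have := congrArg Matrix.transpose hAV
    rwa [transpose_mul, transpose_sub, hMT, hDT, hVs.eq] at this
  have hAT : Aᵀ = V⁻¹ * (M - D) := by
    rw [← hVA, ← Matrix.mul_assoc, Matrix.nonsing_inv_mul _ hVu, Matrix.one_mul]
  -- trace identities
  have t1 : (Aᵀ * D⁻¹ * A * V).trace
      = (V⁻¹ * (M * D⁻¹ * M)).trace - 2 * (V⁻¹ * M).trace + (V⁻¹ * D).trace := by
    have : (M - D) * D⁻¹ * (M - D) = M * D⁻¹ * M - M - M + D := by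
      rw [Matrix.sub_mul, Matrix.mul_nonsing_inv _ hDu, Matrix.sub_mul, Matrix.mul_sub,
        Matrix.mul_assoc M D⁻¹ D, Matrix.nonsing_inv_mul _ hDu]
      simp only [Matrix.one_mul, Matrix.mul_one]
      abel
    rw [Matrix.mul_assoc _ A V, hAV, hAT, Matrix.mul_assoc, Matrix.mul_assoc,
      ← Matrix.mul_assoc (M - D), this]
    simp only [Matrix.mul_add, Matrix.mul_sub, trace_add, trace_sub]
    ring
  have t2 : A.trace = (V⁻¹ * M).trace - (V⁻¹ * D).trace := by
    rw [hA, Matrix.trace_mul_comm, Matrix.mul_sub, trace_sub]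
  have t3 : (A * V + V * Aᵀ + (2 : ℝ) • D).trace = 2 * M.trace := by
    rw [hAV, hVA]
    simp only [trace_add, trace_sub, trace_smul, smul_eq_mul]
    ring
  have t4 : μd ⬝ᵥ (D⁻¹ *ᵥ μd) ≤ μd ⬝ᵥ μd * (D⁻¹).trace := by
    have h := aux_trace (vecMulVec μd μd) D⁻¹
      (by simpa using Matrix.posSemidef_vecMulVec_self_star μd) hDi
    rw [Matrix.trace_mul_comm, Matrix.mul_vecMulVec, Matrix.trace_vecMulVec,
      Matrix.trace_vecMulVec, dotProduct_comm] at h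
    exact h
  have hMDM : (M * D⁻¹ * M).PosSemidef := by
    have := hDi.conjTranspose_mul_mul_same M
    rwa [hAVD.1.eq] at this
  have hMM : (M * M).PosSemidef := by
    have := Matrix.posSemidef_conjTranspose_mul_self M
    rwa [hAVD.1.eq] at this
  have i1 := aux_trace _ _ hVi hMDM
  have i2 : (M * D⁻¹ * M).trace ≤ (D⁻¹).trace * (M * M).trace := by
    rw [Matrix.mul_assoc, Matrix.trace_mul_comm, Matrix.mul_assoc]
    exact aux_trace _ _ hDi hMM
  have i3 := aux_trace _ _ hAVD hAVD
  have v0 : 0 ≤ (V⁻¹).trace := hVi.trace_nonneg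
  have d0 : 0 ≤ (D⁻¹).trace := hDi.trace_nonneg
  have i4 := mul_le_mul_of_nonneg_left (i2.trans (mul_le_mul_of_nonneg_left i3 d0)) v0
  rw [t1, t2, t3]
  linarith
end
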